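/- arXiv:2104.14742 — 2 statements merged into one kernel-verified Lean document; each statement's English description precedes it below -/
import Mathlib

section
/- Let n ≥ 2 and let α be a real number with α > −1/2. Then for every digraph D on n vertices without isolated vertices, χ_α(D) ≤ 2^{α−1}·n·(n−1)^{α+1}, and equality holds if and only if D is isomorphic to the complete symmetric digraph K⃡_n. -/
open Finset

/-- The out-degree of a vertex `u` in the digraph on `Fin n` with arc set `A`. -/
def outDeg {n : ℕ} (A : Finset (Fin n × Fin n)) (u : Fin n) : ℕ :=
  (A.filter (fun a => a.1 = u)).card

/-- The in-degree of a vertex `u` in the digraph on `Fin n` with arc set `A`. -/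
def inDeg {n : ℕ} (A : Finset (Fin n × Fin n)) (u : Fin n) : ℕ :=
  (A.filter (fun a => a.2 = u)).card

/-- The vertex-degree-based invariant `I(D) = (1/2) ∑_{uv ∈ A} φ(d⁺(u), d⁻(v))`. -/
noncomputable def vdbI {n : ℕ} (A : Finset (Fin n × Fin n)) (φ : ℕ → ℕ → ℝ) : ℝ :=
  (1 / 2 : ℝ) * ∑ a ∈ A, φ (outDeg A a.1) (inDeg A a.2)

/-- `D` is (isomorphic to) the out-star `K⃗_{1,n-1}`: all arcs from a center `c`. -/
def IsStarOut {n : ℕ} (A : Finset (Fin n × Fin n)) : Prop :=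
  ∃ c : Fin n, A = Finset.univ.filter (fun a => a.1 = c ∧ a.2 ≠ c)

/-- `D` is (isomorphic to) the in-star `K⃗_{n-1,1}`: all arcs into a center `c`. -/
def IsStarIn {n : ℕ} (A : Finset (Fin n × Fin n)) : Prop :=
  ∃ c : Fin n, A = Finset.univ.filter (fun a => a.2 = c ∧ a.1 ≠ c)

/-- `D` is the complete symmetric digraph `K⃡_n`: all ordered pairs of distinct vertices. -/
def IsCompleteSym {n : ℕ} (A : Finset (Fin n × Fin n)) : Prop :=
  A = Finset.univ.filter (fun a => a.1 ≠ a.2)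

/-- The reciprocals of the fibre sizes of a map add up to the number of nonempty fibres. -/
lemma sum_inv_card_fiber {ι κ : Type*} [Fintype κ] [DecidableEq κ] (A : Finset ι) (f : ι → κ) :
    ∑ a ∈ A, ((#{b ∈ A | f b = f a} : ℝ))⁻¹ = ∑ k : κ, if #{b ∈ A | f b = k} = 0 then 0 else 1 := by
  rw [← Finset.sum_fiberwise A f]
  refine Finset.sum_congr rfl fun k _ => ?_
  have h : ∑ a ∈ A with f a = k, ((#{b ∈ A | f b = f a} : ℝ))⁻¹ =
      ∑ a ∈ A with f a = k, ((#{b ∈ A | f b = k} : ℝ))⁻¹ :=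
    Finset.sum_congr rfl fun a ha => by rw [(Finset.mem_filter.mp ha).2]
  rw [h, Finset.sum_const, nsmul_eq_mul]
  split_ifs with h0
  · simp [h0]
  · exact mul_inv_cancel₀ (by exact_mod_cast h0)

lemma sum_inv_card_fiber_le {ι κ : Type*} [Fintype κ] [DecidableEq κ] (A : Finset ι) (f : ι → κ) :
    ∑ a ∈ A, ((#{b ∈ A | f b = f a} : ℝ))⁻¹ ≤ Fintype.card κ := by
  rw [sum_inv_card_fiber]
  calc _ ≤ ∑ k : κ, (1 : ℝ) := Finset.sum_le_sum fun k _ => by split_ifs <;> norm_num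
    _ = _ := by simp

lemma sum_inv_card_fiber_lt {ι κ : Type*} [Fintype κ] [DecidableEq κ] (A : Finset ι) (f : ι → κ)
    (k : κ) (hk : #{b ∈ A | f b = k} = 0) :
    ∑ a ∈ A, ((#{b ∈ A | f b = f a} : ℝ))⁻¹ < Fintype.card κ := by
  rw [sum_inv_card_fiber]
  calc _ < ∑ k : κ, (1 : ℝ) :=
        Finset.sum_lt_sum (fun k _ => by split_ifs <;> norm_num)
          ⟨k, Finset.mem_univ k, by simp only [if_pos hk]; norm_num⟩
    _ = _ := by simp

lemma outDeg_eq_card {n : ℕ} (A : Finset (Fin n × Fin n)) (u : Fin n) :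
    outDeg A u = #{v | (u, v) ∈ A} := by
  refine Finset.card_nbij' Prod.snd (fun v => (u, v)) ?_ ?_ ?_ ?_ <;>
    simp +contextual [Set.MapsTo, Set.LeftInvOn]
  rintro _ _ h rfl
  exact h

lemma inDeg_eq_card {n : ℕ} (A : Finset (Fin n × Fin n)) (v : Fin n) :
    inDeg A v = #{u | (u, v) ∈ A} := by
  refine Finset.card_nbij' Prod.fst (fun u => (u, v)) ?_ ?_ ?_ ?_ <;>
    simp +contextual [Set.MapsTo, Set.LeftInvOn]
  rintro _ _ h rfl
  exact h

lemma outDeg_le {n : ℕ} {A : Finset (Fin n × Fin n)} (harc : ∀ a ∈ A, a.1 ≠ a.2) (u : Fin n) :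
    outDeg A u ≤ n - 1 := by
  have h : ({v | (u, v) ∈ A} : Finset (Fin n)) ⊆ Finset.univ.erase u := fun v hv => by
    simpa using (harc _ (Finset.mem_filter.mp hv).2).symm
  simpa [outDeg_eq_card] using Finset.card_le_card h

lemma inDeg_le {n : ℕ} {A : Finset (Fin n × Fin n)} (harc : ∀ a ∈ A, a.1 ≠ a.2) (v : Fin n) :
    inDeg A v ≤ n - 1 := by
  have h : ({u | (u, v) ∈ A} : Finset (Fin n)) ⊆ Finset.univ.erase v := fun u hu => by
    simpa using harc _ (Finset.mem_filter.mp hu).2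
  simpa [inDeg_eq_card] using Finset.card_le_card h

lemma outDeg_lt {n : ℕ} {A : Finset (Fin n × Fin n)} (harc : ∀ a ∈ A, a.1 ≠ a.2) {u v : Fin n}
    (huv : u ≠ v) (hA : (u, v) ∉ A) : outDeg A u < n - 1 := by
  have h : ({v | (u, v) ∈ A} : Finset (Fin n)) ⊂ Finset.univ.erase u := by
    refine Finset.ssubset_iff_subset_ne.mpr ⟨fun w hw => ?_, fun h => ?_⟩
    · simpa using (harc _ (Finset.mem_filter.mp hw).2).symm
    · have : v ∈ Finset.univ.erase u := by simpa using huv.symm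
      rw [← h] at this
      exact hA (Finset.mem_filter.mp this).2
  simpa [outDeg_eq_card] using Finset.card_lt_card h

lemma outDeg_of_isCompleteSym {n : ℕ} {A : Finset (Fin n × Fin n)} (hA : IsCompleteSym A)
    (u : Fin n) : outDeg A u = n - 1 := by
  have h : ({v | (u, v) ∈ A} : Finset (Fin n)) = Finset.univ.erase u := by
    ext v
    simp [show A = _ from hA, eq_comm]
  simp [outDeg_eq_card, h]

lemma inDeg_of_isCompleteSym {n : ℕ} {A : Finset (Fin n × Fin n)} (hA : IsCompleteSym A)
    (v : Fin n) : inDeg A v = n - 1 := by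
  have h : ({u | (u, v) ∈ A} : Finset (Fin n)) = Finset.univ.erase v := by
    ext u
    simp [show A = _ from hA]
  simp [inDeg_eq_card, h]

lemma card_of_isCompleteSym {n : ℕ} {A : Finset (Fin n × Fin n)} (hA : IsCompleteSym A) :
    #A = n * (n - 1) := by
  rw [Finset.card_eq_sum_card_fiberwise (f := Prod.fst) (t := Finset.univ) (by simp [Set.MapsTo])]
  have h : ∀ u : Fin n, #{a ∈ A | a.1 = u} = n - 1 := outDeg_of_isCompleteSym hA
  simp [h]

lemma inv_add_le_quarter {x y : ℝ} (hx : 0 < x) (hy : 0 < y) :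
    (x + y)⁻¹ ≤ (x⁻¹ + y⁻¹) / 4 := by
  rw [inv_add_inv hx.ne' hy.ne', div_div, inv_eq_one_div, div_le_div_iff₀ (by positivity)
    (by positivity)]
  nlinarith [sq_nonneg (x - y)]

lemma add_rpow_le {α m x y : ℝ} (hα : -1 < α) (hx : 0 < x) (hy : 0 < y) (hxm : x ≤ m)
    (hym : y ≤ m) : (x + y) ^ α ≤ (2 * m) ^ (α + 1) * ((x⁻¹ + y⁻¹) / 4) := by
  have h : (x + y) ^ α = (x + y) ^ (α + 1) * (x + y)⁻¹ := by
    rw [Real.rpow_add_one (by positivity), mul_inv_cancel_right₀ (by positivity)]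
  rw [h]
  exact mul_le_mul (Real.rpow_le_rpow (by positivity) (by linarith) (by linarith))
    (inv_add_le_quarter hx hy) (by positivity) (Real.rpow_nonneg (by linarith) _)

lemma add_rpow_lt {α m x y : ℝ} (hα : -1 < α) (hx : 0 < x) (hy : 0 < y) (hxm : x < m)
    (hym : y ≤ m) : (x + y) ^ α < (2 * m) ^ (α + 1) * ((x⁻¹ + y⁻¹) / 4) := by
  have h : (x + y) ^ α = (x + y) ^ (α + 1) * (x + y)⁻¹ := by
    rw [Real.rpow_add_one (by positivity), mul_inv_cancel_right₀ (by positivity)]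
  rw [h]
  exact mul_lt_mul (Real.rpow_lt_rpow (by positivity) (by linarith) (by linarith))
    (inv_add_le_quarter hx hy) (by positivity) (Real.rpow_nonneg (by linarith) _)

theorem stmt11 (n : ℕ) (hn : 2 ≤ n) (α : ℝ) (hα : -(1 / 2) < α)
    (A : Finset (Fin n × Fin n)) (harc : ∀ a ∈ A, a.1 ≠ a.2)
    (hni : ∀ u : Fin n, outDeg A u ≠ 0 ∨ inDeg A u ≠ 0) :
    vdbI A (fun x y => ((x : ℝ) + (y : ℝ)) ^ α) ≤ (2 : ℝ) ^ (α - 1) * n * ((n : ℝ) - 1) ^ (α + 1) ∧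
      (vdbI A (fun x y => ((x : ℝ) + (y : ℝ)) ^ α) = (2 : ℝ) ^ (α - 1) * n * ((n : ℝ) - 1) ^ (α + 1) ↔ IsCompleteSym A) := by
  have hα' : -1 < α := by linarith
  have hcast : ((n - 1 : ℕ) : ℝ) = (n : ℝ) - 1 := by
    rw [Nat.cast_sub (by omega), Nat.cast_one]
  have hm : (0 : ℝ) < (n : ℝ) - 1 := by
    rw [← hcast]
    exact_mod_cast (by omega : 0 < n - 1)
  set m : ℝ := (n : ℝ) - 1
  have hC : 0 < (2 * m) ^ (α + 1) := by positivity
  have hrhs : (2 : ℝ) ^ (α - 1) * n * m ^ (α + 1) =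
      1 / 2 * ((2 * m) ^ (α + 1) * (((n : ℝ) + n) / 4)) := by
    rw [Real.mul_rpow (by norm_num) hm.le, Real.rpow_sub_one (by norm_num),
      Real.rpow_add_one (x := 2) (by norm_num)]
    ring
  have hsum : ∑ a ∈ A, (2 * m) ^ (α + 1) *
        (((outDeg A a.1 : ℝ)⁻¹ + (inDeg A a.2 : ℝ)⁻¹) / 4) =
      (2 * m) ^ (α + 1) *
        ((∑ a ∈ A, (outDeg A a.1 : ℝ)⁻¹ + ∑ a ∈ A, (inDeg A a.2 : ℝ)⁻¹) / 4) := by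
    rw [← Finset.mul_sum, ← Finset.sum_div, Finset.sum_add_distrib]
  have hout : ∑ a ∈ A, (outDeg A a.1 : ℝ)⁻¹ ≤ n := by
    simpa [outDeg] using sum_inv_card_fiber_le A Prod.fst
  have hin : ∑ a ∈ A, (inDeg A a.2 : ℝ)⁻¹ ≤ n := by
    simpa [inDeg] using sum_inv_card_fiber_le A Prod.snd
  have hxm (u : Fin n) : (outDeg A u : ℝ) ≤ m := by
    rw [← hcast]
    exact_mod_cast outDeg_le harc u
  have hym (u : Fin n) : (inDeg A u : ℝ) ≤ m := by
    rw [← hcast]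
    exact_mod_cast inDeg_le harc u
  have hx {a : Fin n × Fin n} (ha : a ∈ A) : (0 : ℝ) < outDeg A a.1 :=
    Nat.cast_pos.mpr (Finset.card_pos.mpr ⟨a, by simp [ha]⟩)
  have hy {a : Fin n × Fin n} (ha : a ∈ A) : (0 : ℝ) < inDeg A a.2 :=
    Nat.cast_pos.mpr (Finset.card_pos.mpr ⟨a, by simp [ha]⟩)
  have hterm : ∀ a ∈ A, ((outDeg A a.1 : ℝ) + inDeg A a.2) ^ α ≤
      (2 * m) ^ (α + 1) * (((outDeg A a.1 : ℝ)⁻¹ + (inDeg A a.2 : ℝ)⁻¹) / 4) := fun a ha =>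
    add_rpow_le hα' (hx ha) (hy ha) (hxm _) (hym _)
  have hle := (Finset.sum_le_sum hterm).trans_eq hsum
  rw [hrhs, vdbI]
  refine ⟨?_, fun heq => ?_, fun hA => ?_⟩
  · refine mul_le_mul_of_nonneg_left (hle.trans ?_) (by norm_num)
    gcongr
  · by_contra hne
    obtain ⟨u, v, huv, hA⟩ : ∃ u v, u ≠ v ∧ (u, v) ∉ A := by
      by_contra! h
      exact hne (Finset.ext fun a => by
        simpa using ⟨fun ha => harc a ha, fun ha => h a.1 a.2 ha⟩)
    refine ne_of_lt ?_ heq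
    refine mul_lt_mul_of_pos_left ?_ (by norm_num)
    by_cases h0 : outDeg A u = 0
    · refine hle.trans_lt (mul_lt_mul_of_pos_left ?_ hC)
      have : ∑ a ∈ A, (outDeg A a.1 : ℝ)⁻¹ < n := by
        simpa [outDeg] using sum_inv_card_fiber_lt A Prod.fst u h0
      linarith
    · obtain ⟨a, ha⟩ := Finset.card_pos.mp (Nat.pos_of_ne_zero h0)
      obtain ⟨haA, rfl⟩ := Finset.mem_filter.mp ha
      have hlt : (outDeg A a.1 : ℝ) < m := by
        rw [← hcast]
        exact_mod_cast outDeg_lt harc huv hA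
      refine ((Finset.sum_lt_sum hterm ⟨a, haA,
        add_rpow_lt hα' (hx haA) (hy haA) hlt (hym _)⟩).trans_eq hsum).trans_le ?_
      gcongr
  · simp only [outDeg_of_isCompleteSym hA, inDeg_of_isCompleteSym hA, Finset.sum_const,
      card_of_isCompleteSym hA, nsmul_eq_mul, Nat.cast_mul, hcast, ← two_mul]
    rw [Real.rpow_add_one (by positivity)]
    ring
end

section
/- Let α be a real number with −1 ≤ α < 0. Then there exists N such that for every n ≥ N and every digraph D on n vertices without isolated vertices, χ_α(D) ≥ (1/2)·(n−1)·n^α, and equality holds if and only if D is isomorphic to K⃗_{1,n−1} or to K⃗_{n−1,1}. -/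
open Finset

section Weights

lemma sub_one_mul_rpow_lt {α : ℝ} (hα : -1 ≤ α) {k l : ℕ} (hk : 1 ≤ k) (hkl : k < l) :
    ((k : ℝ) - 1) * (k : ℝ) ^ α < ((l : ℝ) - 1) * (l : ℝ) ^ α := by
  have hk' : (1 : ℝ) ≤ k := by exact_mod_cast hk
  have hkl' : (k : ℝ) < l := by exact_mod_cast hkl
  have key : ∀ x : ℝ, 0 < x → (x - 1) * x ^ α = (1 - x⁻¹) * x ^ (α + 1) := by
    intro x hx
    rw [Real.rpow_add_one hx.ne']
    field_simp
  rw [key _ (by linarith), key _ (by linarith)]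
  have h1 : (k : ℝ) ^ (α + 1) ≤ (l : ℝ) ^ (α + 1) :=
    Real.rpow_le_rpow (by linarith) hkl'.le (by linarith)
  have h2 : (l : ℝ)⁻¹ < (k : ℝ)⁻¹ := inv_strictAnti₀ (by linarith) hkl'
  have h3 : (k : ℝ)⁻¹ ≤ 1 := inv_le_one_of_one_le₀ hk'
  have h4 : 0 < (l : ℝ) ^ (α + 1) := Real.rpow_pos_of_pos (by linarith) _
  exact (mul_le_mul_of_nonneg_left h1 (by linarith)).trans_lt
    (mul_lt_mul_of_pos_right (by linarith) h4)

/-- The value `(k - 1) k ^ α` of a star on `k` vertices, averaged over its vertices. -/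
noncomputable def starAverage (α : ℝ) (k : ℕ) : ℝ := ((k : ℝ) - 1) * (k : ℝ) ^ (α - 1)

lemma mul_starAverage (α : ℝ) {k : ℕ} (hk : k ≠ 0) :
    k * starAverage α k = ((k : ℝ) - 1) * (k : ℝ) ^ α := by
  have hk' : (k : ℝ) ≠ 0 := by exact_mod_cast hk
  rw [starAverage, Real.rpow_sub_one hk']
  field_simp

lemma starAverage_nonneg (α : ℝ) {k : ℕ} (hk : 1 ≤ k) : 0 ≤ starAverage α k := by
  have hk' : (1 : ℝ) ≤ k := by exact_mod_cast hk
  exact mul_nonneg (by linarith) (Real.rpow_nonneg (by linarith) _)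

lemma starAverage_pos (α : ℝ) {k : ℕ} (hk : 2 ≤ k) : 0 < starAverage α k := by
  have hk' : (2 : ℝ) ≤ k := by exact_mod_cast hk
  exact mul_pos (by linarith) (Real.rpow_pos_of_pos (by linarith) _)

lemma starAverage_succ_lt {α : ℝ} (hα : α < 0) {k : ℕ} (hk : 2 ≤ k)
    (hkα : 1 - α ≤ -α * k) : starAverage α (k + 1) < starAverage α k := by
  have hk' : (2 : ℝ) ≤ k := by exact_mod_cast hk
  have hk0 : (0 : ℝ) < k := by linarith
  have hinv : 0 < (k : ℝ)⁻¹ := inv_pos.mpr hk0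
  have hb := one_add_mul_self_lt_rpow_one_add (s := (k : ℝ)⁻¹) (by linarith) hinv.ne'
    (p := 1 - α) (by linarith)
  have hsucc : ((k : ℝ) + 1) = k * (1 + (k : ℝ)⁻¹) := by field_simp
  unfold starAverage
  push_cast
  rw [add_sub_cancel_right, hsucc, Real.mul_rpow hk0.le (by linarith)]
  have hp : 0 < (1 + (k : ℝ)⁻¹) ^ (1 - α) := Real.rpow_pos_of_pos (by linarith) _
  have hneg : (1 + (k : ℝ)⁻¹) ^ (α - 1) = ((1 + (k : ℝ)⁻¹) ^ (1 - α))⁻¹ := by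
    rw [← Real.rpow_neg (by linarith), neg_sub]
  have hq : 0 < (k : ℝ) ^ (α - 1) := Real.rpow_pos_of_pos hk0 _
  have hmain : (k : ℝ) < (k - 1) * (1 + (k : ℝ)⁻¹) ^ (1 - α) := by
    refine lt_of_le_of_lt ?_ (mul_lt_mul_of_pos_left hb (by linarith))
    have : ((k : ℝ) - 1) * (1 + (1 - α) * (k : ℝ)⁻¹) - k = (-α * k - (1 - α)) * (k : ℝ)⁻¹ := by
      field_simp
      ring
    have h0 : 0 ≤ (-α * k - (1 - α)) * (k : ℝ)⁻¹ := mul_nonneg (by linarith) hinv.le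
    linarith
  rw [hneg]
  have : (k : ℝ) * ((1 + (k : ℝ)⁻¹) ^ (1 - α))⁻¹ < k - 1 := by
    rw [← div_eq_mul_inv, div_lt_iff₀ hp]
    exact hmain
  calc _ = (k : ℝ) * ((1 + (k : ℝ)⁻¹) ^ (1 - α))⁻¹ * (k : ℝ) ^ (α - 1) := by ring
    _ < _ := mul_lt_mul_of_pos_right this hq

lemma tendsto_starAverage {α : ℝ} (hα : α < 0) :
    Filter.Tendsto (starAverage α) Filter.atTop (nhds 0) := by
  have h0 : Filter.Tendsto (fun k : ℕ => (k : ℝ) ^ α) Filter.atTop (nhds 0) := by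
    have := (tendsto_rpow_neg_atTop (y := -α) (by linarith)).comp
      (tendsto_natCast_atTop_atTop (R := ℝ))
    simpa [Function.comp_def] using this
  refine tendsto_of_tendsto_of_tendsto_of_le_of_le' tendsto_const_nhds h0 ?_ ?_
  · filter_upwards [Filter.eventually_ge_atTop 1] with k hk using starAverage_nonneg α hk
  · filter_upwards [Filter.eventually_ge_atTop 1] with k hk
    have hk' : (1 : ℝ) ≤ k := by exact_mod_cast hk
    have hk0 : (k : ℝ) ≠ 0 := by linarith
    have hq : 0 < (k : ℝ) ^ (α - 1) := Real.rpow_pos_of_pos (by linarith) _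
    calc starAverage α k ≤ k * (k : ℝ) ^ (α - 1) :=
          mul_le_mul_of_nonneg_right (by linarith) hq.le
      _ = (k : ℝ) ^ α := by rw [Real.rpow_sub_one hk0]; field_simp

lemma exists_starAverage_lt {α : ℝ} (hα : α < 0) :
    ∃ N : ℕ, ∀ m, N ≤ m → ∀ k, 2 ≤ k → k < m → starAverage α m < starAverage α k := by
  obtain ⟨K, hK⟩ := exists_nat_ge ((1 - α) / -α)
  rw [div_le_iff₀ (by linarith)] at hK
  have hev : ∀ᶠ m in Filter.atTop, ∀ k ∈ Finset.range (K + 2), 2 ≤ k →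
      starAverage α m < starAverage α k := by
    rw [Filter.eventually_all_finset]
    intro k _
    by_cases hk : 2 ≤ k
    · filter_upwards [(tendsto_starAverage hα).eventually_lt_const (starAverage_pos α hk)]
        with m hm _ using hm
    · simp [hk]
  obtain ⟨N, hN⟩ := Filter.eventually_atTop.mp hev
  refine ⟨N, fun m hm k hk hkm => ?_⟩
  by_cases hkK : k < K + 2
  · exact hN m hm k (Finset.mem_range.mpr hkK) hk
  · have hstep : ∀ j, k ≤ j → starAverage α (j + 1) < starAverage α j := by
      intro j hj
      refine starAverage_succ_lt hα (by omega) ?_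
      have : (K : ℝ) ≤ j := by exact_mod_cast (by omega : K ≤ j)
      nlinarith
    clear hm
    induction m, hkm using Nat.le_induction with
    | base => exact hstep k le_rfl
    | succ j hj ih => exact (hstep j (by omega)).trans ih

end Weights

section ArcGraph

variable {n : ℕ}

/-- The bipartite graph joining the tail copy of `u` to the head copy of `v` for each arc
`(u, v)`. -/
def arcGraph (A : Finset (Fin n × Fin n)) : SimpleGraph (Fin n ⊕ Fin n) :=
  SimpleGraph.fromRel fun x y => ∃ a ∈ A, x = Sum.inl a.1 ∧ y = Sum.inr a.2

lemma arcGraph_adj_of_mem {A : Finset (Fin n × Fin n)} {a : Fin n × Fin n} (ha : a ∈ A) :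
    (arcGraph A).Adj (Sum.inl a.1) (Sum.inr a.2) := by
  simp only [arcGraph, SimpleGraph.fromRel_adj]
  exact ⟨by simp, Or.inl ⟨a, ha, rfl, rfl⟩⟩

/-- The connected component of `arcGraph A` containing a given vertex. -/
abbrev arcComponent (A : Finset (Fin n × Fin n)) (x : Fin n ⊕ Fin n) :
    (arcGraph A).ConnectedComponent :=
  (arcGraph A).connectedComponentMk x

lemma arcComponent_head {A : Finset (Fin n × Fin n)} {a : Fin n × Fin n} (ha : a ∈ A) :
    arcComponent A (Sum.inr a.2) = arcComponent A (Sum.inl a.1) :=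
  SimpleGraph.ConnectedComponent.sound (arcGraph_adj_of_mem ha).reachable.symm

open Classical in
/-- The number of vertices of a component of `arcGraph A`. -/
noncomputable def componentOrder (A : Finset (Fin n × Fin n))
    (C : (arcGraph A).ConnectedComponent) : ℕ :=
  #{x | arcComponent A x = C}

lemma one_le_componentOrder (A : Finset (Fin n × Fin n)) (C : (arcGraph A).ConnectedComponent) :
    1 ≤ componentOrder A C := by
  classical
  obtain ⟨x, hx⟩ := C.nonempty_supp
  exact Finset.card_pos.mpr ⟨x, by simpa [arcComponent] using hx⟩

lemma outDeg_add_inDeg_le_componentOrder {A : Finset (Fin n × Fin n)} {a : Fin n × Fin n}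
    (ha : a ∈ A) :
    outDeg A a.1 + inDeg A a.2 ≤ componentOrder A (arcComponent A (Sum.inl a.1)) := by
  classical
  unfold outDeg inDeg componentOrder
  rw [← Finset.card_disjSum]
  refine Finset.card_le_card_of_injOn
    (Sum.elim (fun b => Sum.inr b.2) (fun b => Sum.inl b.1)) ?_ ?_
  · rintro (b | b) hb
    · obtain ⟨hb, hba⟩ := Finset.mem_filter.mp (Finset.inl_mem_disjSum.mp hb)
      exact Finset.mem_filter.mpr ⟨Finset.mem_univ _, hba ▸ arcComponent_head hb⟩
    · obtain ⟨hb, hba⟩ := Finset.mem_filter.mp (Finset.inr_mem_disjSum.mp hb)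
      refine Finset.mem_filter.mpr ⟨Finset.mem_univ _, ?_⟩
      rw [← arcComponent_head ha, ← hba]
      exact (arcComponent_head hb).symm
  · rintro (b | b) hb (c | c) hc h <;> simp at hb hc h ⊢ <;> ext <;> simp [*]

lemma outDeg_pos {A : Finset (Fin n × Fin n)} {a : Fin n × Fin n} (ha : a ∈ A) :
    1 ≤ outDeg A a.1 :=
  Finset.card_pos.mpr ⟨a, by simpa using ha⟩

lemma inDeg_pos {A : Finset (Fin n × Fin n)} {a : Fin n × Fin n} (ha : a ∈ A) :
    1 ≤ inDeg A a.2 :=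
  Finset.card_pos.mpr ⟨a, by simpa using ha⟩

lemma two_le_componentOrder {A : Finset (Fin n × Fin n)} {a : Fin n × Fin n} (ha : a ∈ A) :
    2 ≤ componentOrder A (arcComponent A (Sum.inl a.1)) := by
  have := outDeg_add_inDeg_le_componentOrder ha
  have := outDeg_pos ha
  have := inDeg_pos ha
  omega

open Classical in
lemma componentOrder_le_card_arcs (A : Finset (Fin n × Fin n))
    (C : (arcGraph A).ConnectedComponent) :
    componentOrder A C ≤ #{a ∈ A | arcComponent A (Sum.inl a.1) = C} + 1 := by
  have h := C.connected_toSimpleGraph.card_vert_le_card_edgeSet_add_one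
  have h1 : Nat.card C = componentOrder A C := by
    rw [componentOrder, ← Nat.subtype_card _ (p := fun x => arcComponent A x = C) (by simp)]
    rfl
  rw [h1] at h
  refine h.trans (Nat.add_le_add_right ?_ 1)
  rw [← Nat.subtype_card _ (p := fun a => a ∈ A ∧ arcComponent A (Sum.inl a.1) = C) (by simp)]
  let f : {a : Fin n × Fin n // a ∈ A ∧ arcComponent A (Sum.inl a.1) = C} →
      C.toSimpleGraph.edgeSet := fun a =>
    ⟨s(⟨Sum.inl a.1.1, a.2.2⟩, ⟨Sum.inr a.1.2, (arcComponent_head a.2.1).trans a.2.2⟩),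
      arcGraph_adj_of_mem a.2.1⟩
  refine Nat.card_le_card_of_surjective f ?_
  rintro ⟨e, he⟩
  induction e using Sym2.ind with
  | _ x y =>
    obtain ⟨x, hx⟩ := x
    obtain ⟨y, hy⟩ := y
    have hxy : (arcGraph A).Adj x y := he
    simp only [arcGraph, SimpleGraph.fromRel_adj] at hxy
    obtain ⟨-, ⟨a, ha, rfl, rfl⟩ | ⟨a, ha, rfl, rfl⟩⟩ := hxy
    · exact ⟨⟨a, ha, hx⟩, rfl⟩
    · exact ⟨⟨a, ha, hy⟩, Subtype.ext Sym2.eq_swap⟩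

open Classical in
lemma sum_starAverage_componentOrder (A : Finset (Fin n × Fin n)) (α : ℝ) :
    ∑ x, starAverage α (componentOrder A (arcComponent A x)) =
      ∑ C, ((componentOrder A C : ℝ) - 1) * (componentOrder A C : ℝ) ^ α := by
  rw [← Finset.sum_fiberwise _ (arcComponent A)]
  refine Finset.sum_congr rfl fun C _ => ?_
  rw [← mul_starAverage α (Nat.one_le_iff_ne_zero.mp (one_le_componentOrder A C)),
    Finset.sum_congr rfl (g := fun _ => starAverage α (componentOrder A C))
      (by intro x hx; rw [(Finset.mem_filter.mp hx).2]),
    Finset.sum_const, nsmul_eq_mul]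
  rfl

/-- The weight of an arc in the general sum-connectivity index. -/
noncomputable def arcWeight (A : Finset (Fin n × Fin n)) (α : ℝ) (a : Fin n × Fin n) : ℝ :=
  ((outDeg A a.1 : ℝ) + (inDeg A a.2 : ℝ)) ^ α

lemma rpow_componentOrder_le_arcWeight {A : Finset (Fin n × Fin n)} {α : ℝ} (hα : α < 0)
    {a : Fin n × Fin n} (ha : a ∈ A) :
    (componentOrder A (arcComponent A (Sum.inl a.1)) : ℝ) ^ α ≤ arcWeight A α a := by
  have h := outDeg_add_inDeg_le_componentOrder ha
  have h1 := outDeg_pos ha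
  refine Real.rpow_le_rpow_of_nonpos ?_ (by exact_mod_cast h) hα.le
  exact_mod_cast (by omega : 0 < outDeg A a.1 + inDeg A a.2)

lemma rpow_lt_arcWeight {A : Finset (Fin n × Fin n)} {α : ℝ} (hα : α < 0)
    {a : Fin n × Fin n} (ha : a ∈ A) {k : ℕ} (hk : outDeg A a.1 + inDeg A a.2 < k) :
    (k : ℝ) ^ α < arcWeight A α a := by
  have h1 := outDeg_pos ha
  refine Real.rpow_lt_rpow_of_neg ?_ (by exact_mod_cast hk) hα
  exact_mod_cast (by omega : 0 < outDeg A a.1 + inDeg A a.2)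

open Classical in
lemma component_sub_one_mul_rpow_le (A : Finset (Fin n × Fin n))
    (C : (arcGraph A).ConnectedComponent) (α : ℝ) :
    ((componentOrder A C : ℝ) - 1) * (componentOrder A C : ℝ) ^ α ≤
      ∑ a ∈ A with arcComponent A (Sum.inl a.1) = C, (componentOrder A C : ℝ) ^ α := by
  rw [Finset.sum_const, nsmul_eq_mul]
  refine mul_le_mul_of_nonneg_right ?_ (Real.rpow_nonneg (Nat.cast_nonneg _) _)
  have : (componentOrder A C : ℝ) ≤ #{a ∈ A | arcComponent A (Sum.inl a.1) = C} + 1 := by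
    exact_mod_cast componentOrder_le_card_arcs A C
  linarith

open Classical in
lemma component_sub_one_mul_rpow_le_sum_arcWeight (A : Finset (Fin n × Fin n))
    (C : (arcGraph A).ConnectedComponent) {α : ℝ} (hα : α < 0) :
    ((componentOrder A C : ℝ) - 1) * (componentOrder A C : ℝ) ^ α ≤
      ∑ a ∈ A with arcComponent A (Sum.inl a.1) = C, arcWeight A α a := by
  refine (component_sub_one_mul_rpow_le A C α).trans (Finset.sum_le_sum fun a ha => ?_)
  obtain ⟨haA, rfl⟩ := Finset.mem_filter.mp ha
  exact rpow_componentOrder_le_arcWeight hα haA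

open Classical in
lemma component_sub_one_mul_rpow_lt_sum_arcWeight {A : Finset (Fin n × Fin n)} {α : ℝ}
    (hα : α < 0) {a : Fin n × Fin n} (ha : a ∈ A) {C : (arcGraph A).ConnectedComponent}
    (haC : arcComponent A (Sum.inl a.1) = C)
    (hlt : outDeg A a.1 + inDeg A a.2 < componentOrder A C) :
    ((componentOrder A C : ℝ) - 1) * (componentOrder A C : ℝ) ^ α <
      ∑ a ∈ A with arcComponent A (Sum.inl a.1) = C, arcWeight A α a := by
  refine (component_sub_one_mul_rpow_le A C α).trans_lt (Finset.sum_lt_sum (fun b hb => ?_)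
    ⟨a, Finset.mem_filter.mpr ⟨ha, haC⟩, rpow_lt_arcWeight hα ha hlt⟩)
  obtain ⟨hbA, rfl⟩ := Finset.mem_filter.mp hb
  exact rpow_componentOrder_le_arcWeight hα hbA

lemma exists_arc_of_nonisolated {A : Finset (Fin n × Fin n)} {u : Fin n}
    (hu : outDeg A u ≠ 0 ∨ inDeg A u ≠ 0) : ∃ a ∈ A, a.1 = u ∨ a.2 = u := by
  rcases hu with hu | hu
  · obtain ⟨a, ha⟩ := Finset.card_ne_zero.mp hu
    exact ⟨a, (Finset.mem_filter.mp ha).1, Or.inl (Finset.mem_filter.mp ha).2⟩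
  · obtain ⟨a, ha⟩ := Finset.card_ne_zero.mp hu
    exact ⟨a, (Finset.mem_filter.mp ha).1, Or.inr (Finset.mem_filter.mp ha).2⟩

theorem sub_one_mul_rpow_le_sum_arcWeight {α : ℝ} (hα₁ : -1 ≤ α) (hα₂ : α < 0) (hn : 1 ≤ n)
    (hN : ∀ k, 2 ≤ k → k < n → starAverage α n < starAverage α k)
    {A : Finset (Fin n × Fin n)} (hA : ∀ u : Fin n, outDeg A u ≠ 0 ∨ inDeg A u ≠ 0) :
    ((n : ℝ) - 1) * (n : ℝ) ^ α ≤ ∑ a ∈ A, arcWeight A α a ∧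
      (∑ a ∈ A, arcWeight A α a = ((n : ℝ) - 1) * (n : ℝ) ^ α →
        ∀ a ∈ A, outDeg A a.1 + inDeg A a.2 = n) := by
  classical
  set order : Fin n ⊕ Fin n → ℕ := fun x => componentOrder A (arcComponent A x)
  have hnonneg : ∀ x, 0 ≤ starAverage α (order x) := fun x =>
    starAverage_nonneg α (one_le_componentOrder A _)
  have hfiber := Finset.sum_fiberwise A (fun a => arcComponent A (Sum.inl a.1)) (arcWeight A α)
  have hle : ∀ C ∈ Finset.univ, ((componentOrder A C : ℝ) - 1) * (componentOrder A C : ℝ) ^ α ≤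
      ∑ a ∈ A with arcComponent A (Sum.inl a.1) = C, arcWeight A α a := fun C _ =>
    component_sub_one_mul_rpow_le_sum_arcWeight A C hα₂
  have hsum := Finset.sum_le_sum hle
  by_cases hbig : ∃ C, n < componentOrder A C
  · obtain ⟨C, hC⟩ := hbig
    have h1 := sub_one_mul_rpow_lt hα₁ hn hC
    have h2 := Finset.single_le_sum (f := fun C : (arcGraph A).ConnectedComponent =>
      ((componentOrder A C : ℝ) - 1) * (componentOrder A C : ℝ) ^ α) (s := Finset.univ)
      (fun D _ => by
        rw [← mul_starAverage α (Nat.one_le_iff_ne_zero.mp (one_le_componentOrder A D))]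
        exact mul_nonneg (Nat.cast_nonneg _) (starAverage_nonneg α (one_le_componentOrder A D)))
      (Finset.mem_univ C)
    have h3 : ((n : ℝ) - 1) * (n : ℝ) ^ α < ∑ a ∈ A, arcWeight A α a := by
      rw [← hfiber]
      exact h1.trans_le (h2.trans hsum)
    exact ⟨h3.le, fun h => absurd h h3.ne'⟩
  · push Not at hbig
    have hanti : ∀ k, 2 ≤ k → k ≤ n → starAverage α n ≤ starAverage α k := fun k hk hkn =>
      hkn.eq_or_lt.elim (fun h => h ▸ le_rfl) (fun h => (hN k hk h).le)
    have hpair : ∀ u ∈ Finset.univ, starAverage α n ≤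
        starAverage α (order (Sum.inl u)) + starAverage α (order (Sum.inr u)) := by
      intro u _
      obtain ⟨a, ha, rfl | rfl⟩ := exists_arc_of_nonisolated (hA u)
      · have := hanti _ (two_le_componentOrder ha) (hbig _)
        linarith [hnonneg (Sum.inr a.1)]
      · have := hanti _ (two_le_componentOrder ha) (hbig _)
        rw [← arcComponent_head ha] at this
        linarith [hnonneg (Sum.inl a.2)]
    have hvert := Finset.sum_le_sum hpair
    have hsplit : ∑ C, ((componentOrder A C : ℝ) - 1) * (componentOrder A C : ℝ) ^ α =
        ∑ u, (starAverage α (order (Sum.inl u)) + starAverage α (order (Sum.inr u))) := by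
      rw [← sum_starAverage_componentOrder, Fintype.sum_sum_type, Finset.sum_add_distrib]
    have hconst : ∑ _u : Fin n, starAverage α n = ((n : ℝ) - 1) * (n : ℝ) ^ α := by
      rw [Finset.sum_const, Finset.card_univ, Fintype.card_fin, nsmul_eq_mul,
        mul_starAverage α (by omega)]
    refine ⟨by linarith, fun heq a ha => ?_⟩
    have heq₁ := (Finset.sum_eq_sum_iff_of_le hpair).mp (by linarith) a.1 (Finset.mem_univ _)
    have heq₂ := (Finset.sum_eq_sum_iff_of_le hle).mp (by linarith)
      (arcComponent A (Sum.inl a.1)) (Finset.mem_univ _)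
    have hordern : componentOrder A (arcComponent A (Sum.inl a.1)) = n := by
      refine (hbig _).eq_or_lt.resolve_right fun hlt => ?_
      have := hN _ (two_le_componentOrder ha) hlt
      linarith [hnonneg (Sum.inr a.1)]
    refine Eq.trans ?_ hordern
    refine (outDeg_add_inDeg_le_componentOrder ha).eq_or_lt.resolve_right fun hlt => ?_
    exact (component_sub_one_mul_rpow_lt_sum_arcWeight hα₂ ha rfl hlt).ne heq₂

end ArcGraph

section Stars

variable {n : ℕ}

lemma fst_eq_or_snd_eq_of_card {A : Finset (Fin n × Fin n)} {a : Fin n × Fin n}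
    (hcard : #A + 1 ≤ outDeg A a.1 + inDeg A a.2) {b : Fin n × Fin n} (hb : b ∈ A) :
    b.1 = a.1 ∨ b.2 = a.2 := by
  have h1 := Finset.card_union_add_card_inter (A.filter fun b => b.1 = a.1)
    (A.filter fun b => b.2 = a.2)
  have h2 : (A.filter fun b => b.1 = a.1) ∩ (A.filter fun b => b.2 = a.2) ⊆ {a} := by
    intro c hc
    simp only [Finset.mem_inter, Finset.mem_filter] at hc
    exact Finset.mem_singleton.mpr (Prod.ext hc.1.2 hc.2.2)
  have h3 := Finset.card_le_card h2
  rw [Finset.card_singleton] at h3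
  have h4 : (A.filter fun b => b.1 = a.1) ∪ (A.filter fun b => b.2 = a.2) = A := by
    refine Finset.eq_of_subset_of_card_le
      (Finset.union_subset (Finset.filter_subset _ _) (Finset.filter_subset _ _)) ?_
    unfold outDeg inDeg at hcard
    omega
  rw [← h4] at hb
  simp only [Finset.mem_union, Finset.mem_filter] at hb
  tauto

lemma card_starOut (c : Fin n) :
    #(Finset.univ.filter fun a : Fin n × Fin n => a.1 = c ∧ a.2 ≠ c) = n - 1 := by
  have : (Finset.univ.filter fun a : Fin n × Fin n => a.1 = c ∧ a.2 ≠ c) =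
      {c} ×ˢ (Finset.univ.erase c) := by
    ext a; simp only [Finset.mem_filter, Finset.mem_univ, true_and, Finset.mem_product,
      Finset.mem_singleton, Finset.mem_erase, and_true]
  rw [this, Finset.card_product, Finset.card_erase_of_mem (Finset.mem_univ c)]
  simp

lemma card_starIn (c : Fin n) :
    #(Finset.univ.filter fun a : Fin n × Fin n => a.2 = c ∧ a.1 ≠ c) = n - 1 := by
  have : (Finset.univ.filter fun a : Fin n × Fin n => a.2 = c ∧ a.1 ≠ c) =
      (Finset.univ.erase c) ×ˢ {c} := by
    ext a; simp only [Finset.mem_filter, Finset.mem_univ, true_and, Finset.mem_product,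
      Finset.mem_singleton, Finset.mem_erase, and_comm]
  rw [this, Finset.card_product, Finset.card_erase_of_mem (Finset.mem_univ c)]
  simp

lemma isStarOut_of_outDeg {A : Finset (Fin n × Fin n)} (hloop : ∀ a ∈ A, a.1 ≠ a.2) {c : Fin n}
    (hcard : #A = n - 1) (hc : n - 1 ≤ outDeg A c) : IsStarOut A := by
  refine ⟨c, Finset.eq_of_subset_of_card_le (fun b hb => ?_) ?_⟩
  · have h : A.filter (fun b => b.1 = c) = A :=
      Finset.eq_of_subset_of_card_le (Finset.filter_subset _ _) (hcard.trans_le hc)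
    rw [← h] at hb
    obtain ⟨hbA, rfl⟩ := Finset.mem_filter.mp hb
    simpa using (hloop b hbA).symm
  · rw [card_starOut, hcard]

lemma isStarIn_of_inDeg {A : Finset (Fin n × Fin n)} (hloop : ∀ a ∈ A, a.1 ≠ a.2) {c : Fin n}
    (hcard : #A = n - 1) (hc : n - 1 ≤ inDeg A c) : IsStarIn A := by
  refine ⟨c, Finset.eq_of_subset_of_card_le (fun b hb => ?_) ?_⟩
  · have h : A.filter (fun b => b.2 = c) = A :=
      Finset.eq_of_subset_of_card_le (Finset.filter_subset _ _) (hcard.trans_le hc)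
    rw [← h] at hb
    obtain ⟨hbA, rfl⟩ := Finset.mem_filter.mp hb
    simpa using hloop b hbA
  · rw [card_starIn, hcard]

lemma isStarOut_or_isStarIn {A : Finset (Fin n × Fin n)} (hloop : ∀ a ∈ A, a.1 ≠ a.2)
    (hn : 2 ≤ n) (hcard : #A = n - 1) (hdeg : ∀ a ∈ A, outDeg A a.1 + inDeg A a.2 = n) :
    IsStarOut A ∨ IsStarIn A := by
  obtain ⟨a, ha⟩ := Finset.card_pos.mp (by omega : 0 < #A)
  have hda := hdeg a ha
  by_cases hin : inDeg A a.2 ≤ 1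
  · exact Or.inl (isStarOut_of_outDeg hloop hcard (c := a.1) (by omega))
  by_cases hout : outDeg A a.1 ≤ 1
  · exact Or.inr (isStarIn_of_inDeg hloop hcard (c := a.2) (by omega))
  push Not at hin hout
  obtain ⟨b, hb, hba⟩ := Finset.exists_mem_ne hout a
  obtain ⟨hb, hb1⟩ := Finset.mem_filter.mp hb
  have hdb := hdeg b hb
  rw [hb1] at hdb
  obtain ⟨c, hc, hcb⟩ := Finset.exists_mem_ne (by omega : 1 < inDeg A b.2) b
  obtain ⟨hc, hc2⟩ := Finset.mem_filter.mp hc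
  rcases fst_eq_or_snd_eq_of_card (a := a) (by omega) hc with h | h
  · exact absurd (Prod.ext (h.trans hb1.symm) hc2) hcb
  · exact absurd (Prod.ext hb1 (hc2.symm.trans h)) hba

lemma card_eq_of_isStar {A : Finset (Fin n × Fin n)} (h : IsStarOut A ∨ IsStarIn A) :
    #A = n - 1 := by
  rcases h with ⟨c, rfl⟩ | ⟨c, rfl⟩
  · exact card_starOut c
  · exact card_starIn c

lemma outDeg_add_inDeg_of_isStar {A : Finset (Fin n × Fin n)} (hn : 1 ≤ n)
    (h : IsStarOut A ∨ IsStarIn A) {a : Fin n × Fin n} (ha : a ∈ A) :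
    outDeg A a.1 + inDeg A a.2 = n := by
  have hcard := card_eq_of_isStar h
  rcases h with ⟨c, hc⟩ | ⟨c, hc⟩
  · have hmem : ∀ b ∈ A, b.1 = c := fun b hb => by
      rw [hc] at hb
      exact (Finset.mem_filter.mp hb).2.1
    have h1 : A.filter (fun b => b.1 = a.1) = A :=
      Finset.filter_true_of_mem fun b hb => (hmem b hb).trans (hmem a ha).symm
    have h2 : A.filter (fun b => b.2 = a.2) = {a} := by
      ext b
      simp only [Finset.mem_filter, Finset.mem_singleton]
      exact ⟨fun hb => Prod.ext ((hmem b hb.1).trans (hmem a ha).symm) hb.2,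
        by rintro rfl; exact ⟨ha, rfl⟩⟩
    rw [outDeg, inDeg, h1, h2, Finset.card_singleton]
    omega
  · have hmem : ∀ b ∈ A, b.2 = c := fun b hb => by
      rw [hc] at hb
      exact (Finset.mem_filter.mp hb).2.1
    have h1 : A.filter (fun b => b.2 = a.2) = A :=
      Finset.filter_true_of_mem fun b hb => (hmem b hb).trans (hmem a ha).symm
    have h2 : A.filter (fun b => b.1 = a.1) = {a} := by
      ext b
      simp only [Finset.mem_filter, Finset.mem_singleton]
      exact ⟨fun hb => Prod.ext hb.2 ((hmem b hb.1).trans (hmem a ha).symm),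
        by rintro rfl; exact ⟨ha, rfl⟩⟩
    rw [outDeg, inDeg, h1, h2, Finset.card_singleton]
    omega

lemma sum_arcWeight_of_forall {A : Finset (Fin n × Fin n)} (α : ℝ)
    (hdeg : ∀ a ∈ A, outDeg A a.1 + inDeg A a.2 = n) :
    ∑ a ∈ A, arcWeight A α a = (#A : ℝ) * (n : ℝ) ^ α := by
  rw [Finset.sum_congr rfl (g := fun _ => (n : ℝ) ^ α), Finset.sum_const, nsmul_eq_mul]
  intro a ha
  rw [arcWeight, ← Nat.cast_add, hdeg a ha]

end Stars

theorem stmt14 (α : ℝ) (hα₁ : -1 ≤ α) (hα₂ : α < 0) :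
    ∃ N : ℕ, ∀ n : ℕ, N ≤ n →
      ∀ A : Finset (Fin n × Fin n), (∀ a ∈ A, a.1 ≠ a.2) →
        (∀ u : Fin n, outDeg A u ≠ 0 ∨ inDeg A u ≠ 0) →
          (1 / 2 : ℝ) * ((n : ℝ) - 1) * (n : ℝ) ^ α ≤ vdbI A (fun x y => ((x : ℝ) + (y : ℝ)) ^ α) ∧
            (vdbI A (fun x y => ((x : ℝ) + (y : ℝ)) ^ α) = (1 / 2 : ℝ) * ((n : ℝ) - 1) * (n : ℝ) ^ α ↔ IsStarOut A ∨ IsStarIn A) := by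
  obtain ⟨N, hN⟩ := exists_starAverage_lt hα₂
  refine ⟨max N 2, fun n hn A hloop hA => ?_⟩
  have hn2 : 2 ≤ n := (le_max_right _ _).trans hn
  obtain ⟨hle, heq⟩ := sub_one_mul_rpow_le_sum_arcWeight hα₁ hα₂ (by omega)
    (hN n ((le_max_left _ _).trans hn)) hA
  have hI : vdbI A (fun x y => ((x : ℝ) + (y : ℝ)) ^ α) =
      (1 / 2 : ℝ) * ∑ a ∈ A, arcWeight A α a := rfl
  have hcast : ((n - 1 : ℕ) : ℝ) = (n : ℝ) - 1 := by
    rw [Nat.cast_sub (by omega), Nat.cast_one]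
  rw [hI, mul_assoc]
  refine ⟨by linarith, fun h => ?_, fun h => ?_⟩
  · have hT : ∑ a ∈ A, arcWeight A α a = ((n : ℝ) - 1) * (n : ℝ) ^ α := by linarith
    have hdeg := heq hT
    rw [sum_arcWeight_of_forall α hdeg, ← hcast] at hT
    have hpos : (n : ℝ) ^ α ≠ 0 := (Real.rpow_pos_of_pos (by positivity) _).ne'
    exact isStarOut_or_isStarIn hloop hn2 (by exact_mod_cast mul_right_cancel₀ hpos hT) hdeg
  · rw [sum_arcWeight_of_forall α fun a ha => outDeg_add_inDeg_of_isStar (by omega) h ha,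
      card_eq_of_isStar h, hcast]
end
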